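/- The 3-forms γ_1 = e^{123} + e^{456} and γ_2 = e^{135} − e^{146} − e^{236} − e^{245} on ℝ^6 are both stable (each has an open GL(6,ℝ)-orbit), and they are not equivalent (no g ∈ GL(6,ℝ) satisfies g^*γ_1 = γ_2). -/

import Mathlib

noncomputable section

/-- The wedge product `f 0 ∧ ⋯ ∧ f (k-1)` of `k` covectors, as an alternating `k`-form:
`(v₁,…,v_k) ↦ det (f i (v j))`. -/
def covectorWedge {V : Type*} [AddCommGroup V] [Module ℝ V] {k : ℕ}
    (f : Fin k → Module.Dual ℝ V) : V [⋀^Fin k]→ₗ[ℝ] ℝ :=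
  (Matrix.detRowAlternating : (Fin k → ℝ) [⋀^Fin k]→ₗ[ℝ] ℝ).compLinearMap (LinearMap.pi f)

/-- The natural topology on the finite-dimensional space of alternating `k`-forms on `ℝⁿ`
(the topology induced by evaluation; it coincides with the standard vector space topology). -/
instance altFormTopology (n k : ℕ) :
    TopologicalSpace ((Fin n → ℝ) [⋀^Fin k]→ₗ[ℝ] ℝ) :=
  TopologicalSpace.induced (fun φ => (⇑φ : (Fin k → Fin n → ℝ) → ℝ)) inferInstance

/-- The pullback `g^*γ` of a `k`-form on `ℝⁿ` by a linear map `g`: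
`(g^*γ)(v₁,…,v_k) = γ (g v₁, …, g v_k)`. -/
def formPullback {n k : ℕ} (g : (Fin n → ℝ) →ₗ[ℝ] (Fin n → ℝ))
    (γ : (Fin n → ℝ) [⋀^Fin k]→ₗ[ℝ] ℝ) : (Fin n → ℝ) [⋀^Fin k]→ₗ[ℝ] ℝ :=
  γ.compLinearMap g

/-- A `k`-form on `ℝⁿ` is stable if its `GL(n,ℝ)`-orbit (under pullback) is open in the
space of all alternating `k`-forms. -/
def IsStableForm {n k : ℕ} (γ : (Fin n → ℝ) [⋀^Fin k]→ₗ[ℝ] ℝ) : Prop :=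
  IsOpen {φ : (Fin n → ℝ) [⋀^Fin k]→ₗ[ℝ] ℝ |
    ∃ g : (Fin n → ℝ) ≃ₗ[ℝ] (Fin n → ℝ), φ = formPullback g.toLinearMap γ}

/-- `e^i ∧ e^j ∧ e^k` on `ℝⁿ`, where `e^1,…,e^n` is the dual of the standard basis
(here indexed from `0`, so the paper's `e^{pqr}` is `eee (p-1) (q-1) (r-1)`). -/
def eee {n : ℕ} (i j k : Fin n) : (Fin n → ℝ) [⋀^Fin 3]→ₗ[ℝ] ℝ :=
  covectorWedge ![LinearMap.proj i, LinearMap.proj j, LinearMap.proj k]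

/-- The form `γ₁ = e^{123} + e^{456}` on `ℝ⁶`. -/
def gammaOne : (Fin 6 → ℝ) [⋀^Fin 3]→ₗ[ℝ] ℝ := eee 0 1 2 + eee 3 4 5

/-- The form `γ₂ = e^{135} - e^{146} - e^{236} - e^{245}`, the real part of
`(e^1+ie^2)∧(e^3+ie^4)∧(e^5+ie^6)`, on `ℝ⁶`. -/
def gammaTwo : (Fin 6 → ℝ) [⋀^Fin 3]→ₗ[ℝ] ℝ := eee 0 2 4 - eee 0 3 5 - eee 1 2 5 - eee 1 3 4

open Filter Topology

/-- A multilinear form on `ℝⁿ` is continuous. -/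
theorem AlternatingMap.continuous_of_pi {n k : ℕ} (γ : (Fin n → ℝ) [⋀^Fin k]→ₗ[ℝ] ℝ) :
    Continuous γ := by
  have h : ∀ v : Fin k → Fin n → ℝ, γ v =
      ∑ w : Fin k → Fin n, (∏ i, v i (w i)) * γ (fun i => Pi.single (w i) 1) := by
    intro v
    have hv : v = fun i => ∑ j, v i j • (Pi.single j 1 : Fin n → ℝ) := by
      funext i
      exact pi_eq_sum_univ' (v i)
    conv_lhs => rw [hv]
    rw [← AlternatingMap.coe_multilinearMap, MultilinearMap.map_sum]
    refine Finset.sum_congr rfl fun w _ => ?_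
    rw [MultilinearMap.map_smul_univ, smul_eq_mul]
  have h' : (γ : (Fin k → Fin n → ℝ) → ℝ) = fun v =>
      ∑ w : Fin k → Fin n, (∏ i, v i (w i)) * γ (fun i => Pi.single (w i) 1) := funext h
  rw [h']
  fun_prop

/-- Alternating forms on `ℝⁿ` agreeing on increasing tuples of standard basis vectors are equal. -/
theorem AlternatingMap.ext_strictMono {n k : ℕ} {φ ψ : (Fin n → ℝ) [⋀^Fin k]→ₗ[ℝ] ℝ}
    (h : ∀ t : Fin k → Fin n, StrictMono t →
      φ (fun i => Pi.single (t i) 1) = ψ (fun i => Pi.single (t i) 1)) : φ = ψ := by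
  refine (Pi.basisFun ℝ (Fin n)).ext_alternating fun v hv => ?_
  simp only [Pi.basisFun_apply]
  have hs := h (v ∘ Tuple.sort v)
    ((Tuple.monotone_sort v).strictMono_of_injective (hv.comp (Tuple.sort v).injective))
  have hφ := φ.map_perm (fun i => Pi.single (v i) 1) (Tuple.sort v)
  have hψ := ψ.map_perm (fun i => Pi.single (v i) 1) (Tuple.sort v)
  have e : (fun i => (Pi.single ((v ∘ Tuple.sort v) i) 1 : Fin n → ℝ)) =
    (fun i => Pi.single (v i) 1) ∘ Tuple.sort v := rfl
  rw [e, hφ, hψ] at hs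
  exact (MulAction.injective (Equiv.Perm.sign (Tuple.sort v))) hs

theorem continuous_formPullback {n k : ℕ} (g : (Fin n → ℝ) →ₗ[ℝ] (Fin n → ℝ)) :
    Continuous (formPullback g : (Fin n → ℝ) [⋀^Fin k]→ₗ[ℝ] ℝ → _) :=
  continuous_induced_rng.2 <| continuous_pi fun v =>
    (continuous_apply (fun i => g (v i))).comp continuous_induced_dom

/-- A form lying in the interior of its own orbit is stable. -/
theorem isStableForm_of_mem_nhds {n k : ℕ} {γ : (Fin n → ℝ) [⋀^Fin k]→ₗ[ℝ] ℝ}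
    (h : {φ : (Fin n → ℝ) [⋀^Fin k]→ₗ[ℝ] ℝ |
      ∃ g : (Fin n → ℝ) ≃ₗ[ℝ] (Fin n → ℝ), φ = formPullback g.toLinearMap γ} ∈ 𝓝 γ) :
    IsStableForm γ := by
  refine isOpen_iff_mem_nhds.2 ?_
  rintro _ ⟨g, rfl⟩
  have hg : formPullback g.symm.toLinearMap (formPullback g.toLinearMap γ) = γ := by
    ext v
    simp [formPullback]
  have hc := (continuous_formPullback (k := k) g.symm.toLinearMap).tendsto
    (formPullback g.toLinearMap γ)
  rw [hg] at hc
  filter_upwards [hc h] with φ hφ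
  obtain ⟨g', hg'⟩ := hφ
  refine ⟨g.trans g', ?_⟩
  ext v
  have := congrArg (fun ψ => ψ (fun i => g (v i))) hg'
  simpa [formPullback, Function.comp_def] using this

/-- Infinitesimal criterion for stability: a form `γ` is stable if every choice of components on
increasing tuples is attained by the derivative of `g ↦ g^*γ` at the identity, in the direction of
the endomorphism with `e_j ↦ A j`. -/
theorem isStableForm_of_infinitesimal {n k : ℕ} (γ : (Fin n → ℝ) [⋀^Fin k]→ₗ[ℝ] ℝ)
    (h : ∀ c : (Fin k → Fin n) → ℝ, ∃ A : Fin n → Fin n → ℝ, ∀ t : Fin k → Fin n, StrictMono t →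
      ∑ i, γ (Function.update (fun j => Pi.single (t j) 1) i (A (t i))) = c t) :
    IsStableForm γ := by
  apply isStableForm_of_mem_nhds
  let I := {t : Fin k → Fin n // StrictMono t}
  let γc : ContinuousMultilinearMap ℝ (fun _ : Fin k => Fin n → ℝ) ℝ :=
    ⟨γ.toMultilinearMap, γ.continuous_of_pi⟩
  let one : Fin n → Fin n → ℝ := fun j => Pi.single j 1
  let F : (Fin n → Fin n → ℝ) → I → ℝ := fun M t => γc (fun i => M (t.1 i))
  let L (t : I) : (Fin n → Fin n → ℝ) →L[ℝ] (Fin k → Fin n → ℝ) :=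
    ContinuousLinearMap.pi fun i => ContinuousLinearMap.proj (t.1 i)
  let F' : (Fin n → Fin n → ℝ) →L[ℝ] (I → ℝ) :=
    ContinuousLinearMap.pi fun t => (γc.linearDeriv (L t one)).comp (L t)
  have hF : HasStrictFDerivAt F F' one :=
    hasStrictFDerivAt_pi.2 fun t =>
      (γc.hasStrictFDerivAt (L t one)).comp one (L t).hasStrictFDerivAt
  have hsurj : F'.range = ⊤ := by
    refine LinearMap.range_eq_top.2 fun c => ?_
    classical
    obtain ⟨A, hA⟩ := h fun t => if ht : StrictMono t then c ⟨t, ht⟩ else 0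
    refine ⟨A, funext fun t => ?_⟩
    have := hA t.1 t.2
    rw [dif_pos t.2] at this
    rw [← this]
    exact γc.linearDeriv_apply _ _
  have hmap := hF.map_nhds_eq_of_surj hsurj
  have hdet : {M : Fin n → Fin n → ℝ | (Matrix.of M).det ≠ 0} ∈ 𝓝 one := by
    have hc : Continuous fun M : Fin n → Fin n → ℝ => (Matrix.of M).det :=
      Continuous.matrix_det continuous_id
    refine (isOpen_ne_fun hc continuous_const).mem_nhds ?_
    have : Matrix.of one = (1 : Matrix (Fin n) (Fin n) ℝ) := by
      ext i j
      simp [one, Matrix.one_apply, Pi.single_apply, eq_comm]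
    simp [this]
  have himg := image_mem_map (m := F) hdet
  rw [hmap] at himg
  have hcoord : Continuous fun (φ : (Fin n → ℝ) [⋀^Fin k]→ₗ[ℝ] ℝ) (t : I) =>
      φ (fun i => Pi.single (t.1 i) 1) :=
    continuous_pi fun t => (continuous_apply _).comp continuous_induced_dom
  filter_upwards [hcoord.tendsto γ himg] with φ hφ
  obtain ⟨M, hM, hMφ⟩ := hφ
  have hdetT : IsUnit (Matrix.of M).transpose.det := by
    rw [Matrix.det_transpose]
    exact isUnit_iff_ne_zero.2 hM
  refine ⟨Matrix.toLinearEquiv' _ (Matrix.invertibleOfIsUnitDet _ hdetT), ?_⟩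
  refine AlternatingMap.ext_strictMono fun t ht => (congrFun hMφ ⟨t, ht⟩).symm.trans ?_
  refine congrArg γ (funext fun i => ?_)
  change M (t i) = Matrix.toLin' (Matrix.of M).transpose (Pi.single (t i) 1)
  ext j
  simp

theorem eee_apply {n : ℕ} (i j k : Fin n) (v : Fin 3 → Fin n → ℝ) :
    eee i j k v =
      v 0 i * v 1 j * v 2 k - v 0 i * v 1 k * v 2 j - v 0 j * v 1 i * v 2 k
      + v 0 j * v 1 k * v 2 i + v 0 k * v 1 i * v 2 j - v 0 k * v 1 j * v 2 i := by
  have : eee i j k v = (Matrix.of fun a => ![v a i, v a j, v a k]).det := by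
    change Matrix.det (n := Fin 3) (R := ℝ) _ = Matrix.det _
    congr 1
    ext a b
    fin_cases b <;> rfl
  rw [this, Matrix.det_fin_three]
  simp only [Matrix.of_apply, Matrix.cons_val]

theorem gammaOne_apply (v : Fin 3 → Fin 6 → ℝ) :
    gammaOne v = eee 0 1 2 v + eee 3 4 5 v := rfl

theorem gammaTwo_apply (v : Fin 3 → Fin 6 → ℝ) :
    gammaTwo v = eee 0 2 4 v - eee 0 3 5 v - eee 1 2 5 v - eee 1 3 4 v := rfl

/-- The infinitesimal criterion for 3-forms, with the sum over the slots written out. -/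
theorem isStableForm_three_of_infinitesimal {n : ℕ} (γ : (Fin n → ℝ) [⋀^Fin 3]→ₗ[ℝ] ℝ)
    (h : ∀ c : Fin n → Fin n → Fin n → ℝ, ∃ A : Fin n → Fin n → ℝ, ∀ i j k, i < j → j < k →
      γ ![A i, Pi.single j 1, Pi.single k 1] + γ ![Pi.single i 1, A j, Pi.single k 1]
        + γ ![Pi.single i 1, Pi.single j 1, A k] = c i j k) :
    IsStableForm γ := by
  refine isStableForm_of_infinitesimal γ fun c => ?_
  obtain ⟨A, hA⟩ := h fun i j k => c ![i, j, k]
  refine ⟨A, fun t ht => ?_⟩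
  have e : t = ![t 0, t 1, t 2] := by
    ext i; fin_cases i <;> rfl
  have := hA (t 0) (t 1) (t 2) (ht (by decide)) (ht (by decide))
  rw [← e] at this
  rw [← this, Fin.sum_univ_three]
  congr 1
  · congr 1 <;> refine congrArg γ (funext fun i => ?_) <;> fin_cases i <;> simp
  · refine congrArg γ (funext fun i => ?_)
    fin_cases i <;> simp

theorem isStableForm_gammaOne : IsStableForm gammaOne := by
  refine isStableForm_three_of_infinitesimal _ fun c => ?_
  refine ⟨![![c 0 1 2, 0, 0, c 0 4 5, -c 0 3 5, c 0 3 4],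
    ![0, 0, 0, c 1 4 5, -c 1 3 5, c 1 3 4],
    ![0, 0, 0, c 2 4 5, -c 2 3 5, c 2 3 4],
    ![c 1 2 3, -c 0 2 3, c 0 1 3, c 3 4 5, 0, 0],
    ![c 1 2 4, -c 0 2 4, c 0 1 4, 0, 0, 0],
    ![c 1 2 5, -c 0 2 5, c 0 1 5, 0, 0, 0]], fun i j k hij hjk => ?_⟩
  simp only [gammaOne_apply, eee_apply]
  fin_cases i <;> fin_cases j <;> first | exact absurd hij (by decide) | skip
  all_goals fin_cases k <;> first | exact absurd hjk (by decide) | simp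

theorem isStableForm_gammaTwo : IsStableForm gammaTwo := by
  refine isStableForm_three_of_infinitesimal _ fun c => ?_
  obtain ⟨p, hp⟩ : ∃ p, p = (c 0 2 4 + c 0 3 5 - c 1 2 5 + c 1 3 4) / 2 := ⟨_, rfl⟩
  obtain ⟨q, hq⟩ : ∃ q, q = (c 0 2 5 - c 0 3 4 - c 1 2 4 - c 1 3 5) / 2 := ⟨_, rfl⟩
  refine ⟨![![-c 0 3 5, -c 0 2 5, c 0 1 5, c 0 1 4, -c 0 1 3, -c 0 1 2],
    ![c 1 2 4 + q, -c 1 2 5 - p, 0, 0, 0, 0],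
    ![-c 2 3 5, -c 2 3 4, p, 0, c 1 2 3, c 0 2 3],
    ![0, 0, c 0 3 4 - c 0 2 5 + q, 0, 0, 0],
    ![c 3 4 5, c 2 4 5, -c 1 4 5, -c 0 4 5, c 0 2 4 + c 0 3 5 - p, q],
    ![0, 0, 0, 0, 0, 0]], fun i j k hij hjk => ?_⟩
  simp only [gammaTwo_apply, eee_apply]
  fin_cases i <;> fin_cases j <;> first | exact absurd hij (by decide) | skip
  all_goals
    fin_cases k <;> first
      | exact absurd hjk (by decide)
      | (simp; done)
      | (simp; linarith)

/-- If `ι_y ι_x γ₂ = 0`, then the vectors `x`, `y` of `ℝ⁶ = ℂ³` have vanishing complex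
cross product. -/
theorem gammaTwo_contract_eq_zero {x y : Fin 6 → ℝ} (h : ∀ z, gammaTwo ![x, y, z] = 0) :
    let X : Fin 3 → ℂ := ![⟨x 0, x 1⟩, ⟨x 2, x 3⟩, ⟨x 4, x 5⟩]
    let Y : Fin 3 → ℂ := ![⟨y 0, y 1⟩, ⟨y 2, y 3⟩, ⟨y 4, y 5⟩]
    ∀ i j, X i * Y j = X j * Y i := by
  intro X Y
  simp only [gammaTwo_apply, eee_apply] at h
  have h0 := h (Pi.single 0 1)
  have h1 := h (Pi.single 1 1)
  have h2 := h (Pi.single 2 1)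
  have h3 := h (Pi.single 3 1)
  have h4 := h (Pi.single 4 1)
  have h5 := h (Pi.single 5 1)
  simp at h0 h1 h2 h3 h4 h5
  intro i j
  fin_cases i <;> fin_cases j <;> simp [X, Y, Complex.ext_iff] <;> constructor <;> linarith

theorem gammaOne_not_equivalent_gammaTwo :
    ¬ ∃ g : (Fin 6 → ℝ) ≃ₗ[ℝ] (Fin 6 → ℝ), formPullback g.toLinearMap gammaOne = gammaTwo := by
  rintro ⟨g, hg⟩
  have hG : ∀ x y z, gammaTwo ![g.symm x, g.symm y, g.symm z] = gammaOne ![x, y, z] := by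
    intro x y z
    rw [← hg]
    refine congrArg gammaOne (funext fun i => ?_)
    fin_cases i <;> simp
  have hcon : ∀ x y, (∀ z, gammaOne ![x, y, z] = 0) →
      ∀ z, gammaTwo ![g.symm x, g.symm y, z] = 0 := by
    intro x y h z
    have := hG x y (g z)
    rw [g.symm_apply_apply] at this
    rw [this, h]
  have h3 := gammaTwo_contract_eq_zero (hcon (Pi.single 0 1) (Pi.single 3 1) fun z => by
    simp [gammaOne_apply, eee_apply])
  have h4 := gammaTwo_contract_eq_zero (hcon (Pi.single 0 1) (Pi.single 4 1) fun z => by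
    simp [gammaOne_apply, eee_apply])
  have h345 := hG (Pi.single 3 1) (Pi.single 4 1) (Pi.single 5 1)
  have hne : g.symm (Pi.single 0 1) ≠ 0 := by
    simp
  generalize g.symm (Pi.single 0 1) = v at *
  generalize g.symm (Pi.single 3 1) = x at *
  generalize g.symm (Pi.single 4 1) = y at *
  generalize g.symm (Pi.single 5 1) = z at *
  dsimp only at h3 h4
  obtain ⟨V, hV⟩ : ∃ V : Fin 3 → ℂ, V = ![⟨v 0, v 1⟩, ⟨v 2, v 3⟩, ⟨v 4, v 5⟩] := ⟨_, rfl⟩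
  obtain ⟨X, hX⟩ : ∃ X : Fin 3 → ℂ, X = ![⟨x 0, x 1⟩, ⟨x 2, x 3⟩, ⟨x 4, x 5⟩] := ⟨_, rfl⟩
  obtain ⟨Y, hY⟩ : ∃ Y : Fin 3 → ℂ, Y = ![⟨y 0, y 1⟩, ⟨y 2, y 3⟩, ⟨y 4, y 5⟩] := ⟨_, rfl⟩
  rw [← hV, ← hX] at h3
  rw [← hV, ← hY] at h4
  have hVne : ∃ a, V a ≠ 0 := by
    by_contra! hz
    have z0 := hz 0
    have z1 := hz 1
    have z2 := hz 2
    simp [hV, Complex.ext_iff] at z0 z1 z2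
    refine hne (funext fun i => ?_)
    fin_cases i <;> simp [z0, z1, z2]
  obtain ⟨a, ha⟩ := hVne
  have hXY : ∀ i j, X i * Y j = X j * Y i := by
    intro i j
    have e : V a * V a * (X i * Y j - X j * Y i) = 0 := by
      linear_combination (V a * Y j) * h3 a i - (V a * Y i) * h3 a j
        + (V i * X a) * h4 a j - (V j * X a) * h4 a i
    have := (mul_eq_zero.1 e).resolve_left (mul_ne_zero ha ha)
    exact sub_eq_zero.1 this
  have h01 := hXY 0 1
  have h02 := hXY 0 2
  have h12 := hXY 1 2
  simp [hX, hY, Complex.ext_iff] at h01 h02 h12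
  simp [gammaOne_apply, gammaTwo_apply, eee_apply] at h345
  obtain ⟨a1, a2⟩ := h01
  obtain ⟨b1, b2⟩ := h02
  obtain ⟨c1, c2⟩ := h12
  have : (1 : ℝ) = 0 := by
    linear_combination -h345 + z 4 * a1 - z 5 * a2 - z 2 * b1 + z 3 * b2 + z 0 * c1 - z 1 * c2
  exact one_ne_zero this

/-- `γ₁` and `γ₂` are stable and inequivalent. -/
theorem gammaOne_gammaTwo_stable_not_equivalent :
    IsStableForm gammaOne ∧ IsStableForm gammaTwo ∧
    ¬ ∃ g : (Fin 6 → ℝ) ≃ₗ[ℝ] (Fin 6 → ℝ), formPullback g.toLinearMap gammaOne = gammaTwo := by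
  exact ⟨isStableForm_gammaOne, isStableForm_gammaTwo, gammaOne_not_equivalent_gammaTwo⟩
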